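/- For k = 1,2 let H_k = S_k⁻ᵀD_kS_k⁻¹ be Hamiltonian matrices with symplectic diagonalizations and V_k := (1/2)·S_k·coth(D_k)·S_kᵀ the corresponding covariance matrices. Write S := S₁ and d_min, d_max for the smallest and largest diagonal entries of D₁. If ‖H₁ − H₂‖∞ ≤ (1/(4‖S‖∞⁶))·e^{−2 d_max − 1}·(1 − e^{−2 d_min}), then ‖V₁ − V₂‖∞ ≤ 4·‖S‖∞⁸·e^{2 d_max + 1}·‖H₁ − H₂‖∞/(1 − e^{−2 d_min})². -/

import Mathlib

open Matrix

/-- The spectral norm (ℓ²→ℓ² operator norm, largest singular value) of a matrix. -/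
noncomputable def spNorm {𝕜 : Type*} [RCLike 𝕜] {p q : Type*} [Fintype p] [Fintype q]
    [DecidableEq q] (A : Matrix p q 𝕜) : ℝ :=
  ‖LinearMap.toContinuousLinearMap (Matrix.toEuclideanLin A)‖

/-- Index set for `2m × 2m` matrices: the pair `(i, δ)` stands for the index `2i - δ`,
`(i, 0)` being the first index of the `i`-th pair and `(i, 1)` the second. -/
abbrev Idx (m : ℕ) := Fin m × Fin 2

/-- The standard symplectic form: block diagonal with `m` blocks `[[0,1],[-1,0]]`. -/
def Omega (m : ℕ) : Matrix (Idx m) (Idx m) ℝ :=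
  Matrix.of fun p q =>
    if p.1 = q.1 ∧ p.2 = 0 ∧ q.2 = 1 then 1
    else if p.1 = q.1 ∧ p.2 = 1 ∧ q.2 = 0 then -1 else 0

/-- The diagonal matrix `diag (d₁, d₁, …, d_m, d_m)`. -/
def pairDiag {m : ℕ} (d : Fin m → ℝ) : Matrix (Idx m) (Idx m) ℝ :=
  Matrix.diagonal fun p => d p.1

/-- Hyperbolic cotangent. -/
noncomputable def rcoth (x : ℝ) : ℝ := Real.cosh x / Real.sinh x

/-- A real matrix regarded as a complex matrix. -/
def cplx {p q : Type*} (A : Matrix p q ℝ) : Matrix p q ℂ :=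
  A.map (fun x => (x : ℂ))

section mainproof
open scoped Matrix.Norms.L2Operator Kronecker Nat

theorem aux_pow {A : Type*} [NormedRing A] (x y : A) (r : ℝ) (hx : ‖x‖ ≤ r) (hy : ‖y‖ ≤ r) (n : ℕ) :
    ‖x ^ (n+1) - y ^ (n+1)‖ ≤ (n+1) * r ^ n * ‖x - y‖ := by
  have hr : 0 ≤ r := (norm_nonneg x).trans hx
  induction n with
  | zero => simp
  | succ n ih =>
    have e : x ^ (n+1+1) - y ^ (n+1+1) = x ^ (n+1) * (x - y) + (x ^ (n+1) - y ^ (n+1)) * y := by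
      rw [pow_succ x (n+1), pow_succ y (n+1)]; noncomm_ring
    have h1 : ‖x ^ (n+1)‖ ≤ r ^ (n+1) :=
      (norm_pow_le' x (Nat.succ_pos n)).trans (by gcongr)
    calc _ ≤ ‖x ^ (n+1) * (x - y)‖ + ‖(x ^ (n+1) - y ^ (n+1)) * y‖ := by rw [e]; exact norm_add_le _ _
      _ ≤ r ^ (n+1) * ‖x - y‖ + ((n+1) * r ^ n * ‖x - y‖) * r := by
        refine add_le_add ((norm_mul_le _ _).trans (by gcongr)) ((norm_mul_le _ _).trans (by gcongr))
      _ = _ := by push_cast; ring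

theorem aux_exp {A : Type*} [NormedRing A] [NormedAlgebra ℂ A] [CompleteSpace A]
    (x y : A) (r : ℝ) (hx : ‖x‖ ≤ r) (hy : ‖y‖ ≤ r) :
    ‖NormedSpace.exp x - NormedSpace.exp y‖ ≤ ‖x - y‖ * Real.exp r := by
  have h := (NormedSpace.exp_series_hasSum_exp' (𝕂 := ℂ) x).sub
    (NormedSpace.exp_series_hasSum_exp' (𝕂 := ℂ) y)
  have h1 := (hasSum_nat_add_iff' 1).mpr h
  simp only [Finset.range_one, Finset.sum_singleton, pow_zero, sub_self, sub_zero] at h1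
  have h2 : HasSum (fun n : ℕ => ‖x - y‖ * (r ^ n / n !)) (‖x - y‖ * Real.exp r) := by
    have := NormedSpace.expSeries_div_hasSum_exp (𝔸 := ℝ) r
    rw [← Real.exp_eq_exp_ℝ] at this
    exact this.mul_left _
  rw [← h1.tsum_eq]
  refine tsum_of_norm_bounded h2 fun n => ?_
  rw [← smul_sub, norm_smul]
  have h3 := aux_pow x y r hx hy n
  have h4 : ‖(((n+1)! : ℂ))⁻¹‖ = ((n+1)! : ℝ)⁻¹ := by
    rw [norm_inv, Complex.norm_natCast]
  rw [h4]
  calc _ ≤ ((n+1)! : ℝ)⁻¹ * ((n+1) * r ^ n * ‖x - y‖) := by gcongr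
    _ = _ := by
      rw [Nat.factorial_succ]; push_cast
      have : ((n:ℝ)+1) ≠ 0 := by positivity
      have : (n ! : ℝ) ≠ 0 := by positivity
      field_simp

theorem aux_conj {n : Type*} [Fintype n] [DecidableEq n] (R R' : Matrix n n ℂ) (a : n → ℝ)
    (h1 : R * R' = 1) (h2 : R' * R = 1) :
    NormedSpace.exp (R * diagonal (fun i => ((2 * a i : ℝ) : ℂ)) * R') =
      R * diagonal (fun i => ((Real.exp (2 * a i) : ℝ) : ℂ)) * R' := by
  have := Matrix.exp_units_conj (⟨R, R', h1, h2⟩ : (Matrix n n ℂ)ˣ)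
    (diagonal (fun i => ((2 * a i : ℝ) : ℂ)))
  simp only [Units.val_mk, Units.inv_mk] at this
  rw [Matrix.exp_diagonal] at this
  refine this.trans ?_
  congr 3
  funext i
  rw [Pi.coe_exp, ← Complex.exp_eq_exp_ℂ, Complex.ofReal_exp]

/-- the vector `1/(e^{2a}-1)` -/
noncomputable def gv {n : Type*} (a : n → ℝ) : n → ℂ := fun i => (((Real.exp (2 * a i) - 1)⁻¹ : ℝ) : ℂ)

theorem aux_inv {n : Type*} [Fintype n] [DecidableEq n] (R R' : Matrix n n ℂ) (a : n → ℝ)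
    (ha : ∀ i, a i ≠ 0) (h1 : R * R' = 1) (h2 : R' * R = 1) :
    (NormedSpace.exp (R * diagonal (fun i => ((2 * a i : ℝ) : ℂ)) * R') - 1) *
      (R * diagonal (gv a) * R') = 1 ∧
    (R * diagonal (gv a) * R') *
    (NormedSpace.exp (R * diagonal (fun i => ((2 * a i : ℝ) : ℂ)) * R') - 1) = 1 := by
  have e : NormedSpace.exp (R * diagonal (fun i => ((2 * a i : ℝ) : ℂ)) * R') - 1 =
      R * diagonal (fun i => ((Real.exp (2 * a i) - 1 : ℝ) : ℂ)) * R' := by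
    rw [aux_conj R R' a h1 h2]
    have : diagonal (fun i => ((Real.exp (2 * a i) - 1 : ℝ) : ℂ)) =
      diagonal (fun i => ((Real.exp (2 * a i) : ℝ) : ℂ)) - 1 := by
      rw [← Matrix.diagonal_one, Matrix.diagonal_sub]
      simp
    rw [this, mul_sub, sub_mul, mul_one, h1]
  have hne : ∀ i, Real.exp (2 * a i) - 1 ≠ 0 := fun i h => by
    have : Real.exp (2 * a i) = 1 := by linarith
    rw [Real.exp_eq_one_iff] at this
    exact ha i (by linarith)
  have k1 : diagonal (fun i => ((Real.exp (2 * a i) - 1 : ℝ) : ℂ)) * diagonal (gv a) = 1 := by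
    rw [Matrix.diagonal_mul_diagonal, ← Matrix.diagonal_one]
    congr 1; funext i
    rw [gv, ← Complex.ofReal_mul, mul_inv_cancel₀ (hne i)]; simp
  have k2 : diagonal (gv a) * diagonal (fun i => ((Real.exp (2 * a i) - 1 : ℝ) : ℂ)) = 1 := by
    rw [Matrix.diagonal_mul_diagonal, ← Matrix.diagonal_one]
    congr 1; funext i
    rw [gv, ← Complex.ofReal_mul, inv_mul_cancel₀ (hne i)]; simp
  rw [e]
  constructor
  · calc _ = R * diagonal (fun i => ((Real.exp (2 * a i) - 1 : ℝ) : ℂ)) * (R' * R) *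
        diagonal (gv a) * R' := by simp only [mul_assoc]
      _ = R * (diagonal (fun i => ((Real.exp (2 * a i) - 1 : ℝ) : ℂ)) * diagonal (gv a)) * R' := by
        rw [h2]; simp only [mul_assoc, mul_one]
      _ = 1 := by rw [k1, mul_one, h1]
  · calc _ = R * diagonal (gv a) * (R' * R) *
        diagonal (fun i => ((Real.exp (2 * a i) - 1 : ℝ) : ℂ)) * R' := by simp only [mul_assoc]
      _ = R * (diagonal (gv a) * diagonal (fun i => ((Real.exp (2 * a i) - 1 : ℝ) : ℂ))) * R' := by
        rw [h2]; simp only [mul_assoc, mul_one]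
      _ = 1 := by rw [k2, mul_one, h1]

/-- core perturbation estimate in the diagonalising frame of the first matrix -/
theorem aux_core {n : Type*} [Fintype n] [DecidableEq n] (Q Q' : Matrix n n ℂ) (a b : n → ℝ)
    (ha : ∀ i, a i ≠ 0) (hb : ∀ i, b i ≠ 0) (h1 : Q * Q' = 1) (h2 : Q' * Q = 1)
    (c M ε : ℝ) (hc : 0 < c) (hε1 : ε ≤ 1)
    (hM : ∀ i, |2 * a i| ≤ M) (hM0 : 0 ≤ M) (hg : ‖diagonal (gv a)‖ ≤ 1 / c)
    (hE : ‖diagonal (fun i => ((2 * a i : ℝ) : ℂ)) -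
      Q * diagonal (fun i => ((2 * b i : ℝ) : ℂ)) * Q'‖ ≤ ε)
    (hsmall : ε * Real.exp (M + 1) ≤ c / 2) :
    ‖diagonal (gv a) - Q * diagonal (gv b) * Q'‖ ≤ 2 / c ^ 2 * (ε * Real.exp (M + 1)) := by
  set A := diagonal (fun i => ((2 * a i : ℝ) : ℂ)) with hA
  set B := Q * diagonal (fun i => ((2 * b i : ℝ) : ℂ)) * Q' with hB
  obtain ⟨p1, p2⟩ := aux_inv Q Q' b hb h1 h2
  obtain ⟨q1, q2⟩ := aux_inv (1 : Matrix n n ℂ) 1 a ha (by simp) (by simp)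
  simp only [one_mul, mul_one] at q1 q2
  rw [← hA] at q1 q2
  rw [← hB] at p1 p2
  set G := diagonal (gv a)
  set K := Q * diagonal (gv b) * Q'
  have hε0 : 0 ≤ ε := (norm_nonneg _).trans hE
  have nA : ‖A‖ ≤ M := by
    rw [hA, Matrix.l2_opNorm_diagonal, pi_norm_le_iff_of_nonneg hM0]
    intro i
    rw [Complex.norm_real]; exact hM i
  have nB : ‖B‖ ≤ M + 1 := by
    have : B = A - (A - B) := by abel
    rw [this]
    exact (norm_sub_le _ _).trans (by linarith)
  have hΔ : ‖NormedSpace.exp A - NormedSpace.exp B‖ ≤ ε * Real.exp (M+1) :=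
    (aux_exp A B (M+1) (by linarith) nB).trans (by gcongr)
  set t := ε * Real.exp (M+1)
  have ht : 0 ≤ t := by positivity
  have id1 : G - K = -(G * (NormedSpace.exp A - NormedSpace.exp B) * K) := by
    calc G - K = G * ((NormedSpace.exp B - 1) * K) - (G * (NormedSpace.exp A - 1)) * K := by
          rw [p1, q2, mul_one, one_mul]
      _ = _ := by noncomm_ring
  have hGK : ‖G - K‖ ≤ 1 / c * t * ‖K‖ := by
    rw [id1, norm_neg]
    refine (norm_mul_le _ _).trans ?_
    gcongr
    exact (norm_mul_le _ _).trans (by gcongr)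
  have hK : ‖K‖ ≤ 2 / c := by
    have : ‖K‖ ≤ ‖G‖ + ‖G - K‖ := by
      have : K = G - (G - K) := by abel
      conv_lhs => rw [this]
      exact norm_sub_le _ _
    have h5 : 1 / c * t * ‖K‖ ≤ 1 / c * (c/2) * ‖K‖ := by gcongr
    have h6 : 1 / c * (c/2) * ‖K‖ = ‖K‖ / 2 := by field_simp
    have h7 : 2 / c = 2 * (1 / c) := by ring
    linarith
  calc _ ≤ 1 / c * t * (2 / c) := hGK.trans (by gcongr)
    _ = _ := by field_simp

section cplxlemmas
variable {n : Type*} [Fintype n] [DecidableEq n]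

theorem cplx_mul (A B : Matrix n n ℝ) : cplx (A * B) = cplx A * cplx B :=
  Matrix.map_mul (f := Complex.ofRealHom)

theorem cplx_sub (A B : Matrix n n ℝ) : cplx (A - B) = cplx A - cplx B := by
  ext i j; simp [cplx]

theorem cplx_norm_le (A : Matrix n n ℝ) : ‖cplx A‖ ≤ spNorm A := by
  have hsp : 0 ≤ spNorm A := norm_nonneg _
  rw [Matrix.l2_opNorm_def]
  refine ContinuousLinearMap.opNorm_le_bound _ (norm_nonneg _) fun z => ?_
  have hre : ∀ x : n → ℝ, ∑ i, (A *ᵥ x) i ^ 2 ≤ spNorm A ^ 2 * ∑ i, x i ^ 2 := fun x => by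
    have h := (LinearMap.toContinuousLinearMap (Matrix.toEuclideanLin A)).le_opNorm (WithLp.toLp 2 x)
    have h' := pow_le_pow_left₀ (norm_nonneg _) h 2
    rw [mul_pow, EuclideanSpace.norm_sq_eq, EuclideanSpace.norm_sq_eq] at h'
    simpa [spNorm] using h'
  refine (sq_le_sq₀ (by positivity) (by positivity)).mp ?_
  rw [mul_pow, EuclideanSpace.norm_sq_eq, EuclideanSpace.norm_sq_eq]
  have e1 : ∀ w : ℂ, ‖w‖ ^ 2 = w.re ^ 2 + w.im ^ 2 := fun w => by
    rw [Complex.sq_norm, Complex.normSq_apply]; ring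
  have e2 : ∀ i, (cplx A *ᵥ z) i = ((A *ᵥ fun j => (z j).re) i : ℂ) + ((A *ᵥ fun j => (z j).im) i : ℂ) * Complex.I := by
    intro i
    simp only [Matrix.mulVec, dotProduct, cplx, Matrix.map_apply, Complex.ofReal_sum, Finset.sum_mul, ← Finset.sum_add_distrib]
    refine Finset.sum_congr rfl fun j _ => ?_
    conv_lhs => rw [← Complex.re_add_im (z j)]
    push_cast; ring
  have h1 := hre fun j => (z j).re
  have h2 := hre fun j => (z j).im
  have e3 : ∀ i, ‖(((Matrix.toEuclideanLin (𝕜 := ℂ)).trans LinearMap.toContinuousLinearMap (cplx A)) z) i‖ ^ 2 = (A *ᵥ fun j => (z j).re) i ^ 2 + (A *ᵥ fun j => (z j).im) i ^ 2 := by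
    intro i
    have : (((Matrix.toEuclideanLin (𝕜 := ℂ)).trans LinearMap.toContinuousLinearMap (cplx A)) z) i = (cplx A *ᵥ z) i := rfl
    rw [this, e2, e1]; simp
  simp only [e3, e1 (z _)]
  rw [Finset.sum_add_distrib, Finset.sum_add_distrib, mul_add]
  exact add_le_add h1 h2

theorem le_cplx_norm (A : Matrix n n ℝ) : spNorm A ≤ ‖cplx A‖ := by
  refine ContinuousLinearMap.opNorm_le_bound _ (norm_nonneg _) fun x => ?_
  have h := Matrix.l2_opNorm_mulVec (cplx A) (WithLp.toLp 2 fun j => (x j : ℂ))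
  have h' := pow_le_pow_left₀ (norm_nonneg _) h 2
  refine (sq_le_sq₀ (by positivity) (by positivity)).mp ?_
  rw [mul_pow, EuclideanSpace.norm_sq_eq, EuclideanSpace.norm_sq_eq] at h' ⊢
  have e2 : ∀ i, (cplx A *ᵥ fun j => (x j : ℂ)) i = ((A *ᵥ x) i : ℂ) := by
    intro i
    simp [Matrix.mulVec, dotProduct, cplx]
  simpa [e2] using h'

theorem cplx_transpose_norm (A : Matrix n n ℝ) : ‖cplx Aᵀ‖ = ‖cplx A‖ := by
  have : cplx Aᵀ = (cplx A)ᴴ := by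
    ext i j; simp [cplx, Matrix.conjTranspose_apply]
  rw [this, Matrix.l2_opNorm_conjTranspose]
end cplxlemmas

/-- the block of `i Ω` -/
noncomputable def wb : Matrix (Fin 2) (Fin 2) ℂ := !![0, Complex.I; -Complex.I, 0]

/-- unitary diagonalising `wb` -/
noncomputable def ub : Matrix (Fin 2) (Fin 2) ℂ :=
  ((Real.sqrt 2 : ℝ) : ℂ)⁻¹ • !![1, 1; -Complex.I, Complex.I]

/-- `i Ω` -/
noncomputable def Wc (m : ℕ) : Matrix (Idx m) (Idx m) ℂ := (1 : Matrix (Fin m) (Fin m) ℂ) ⊗ₖ wb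

/-- unitary diagonalising `i Ω` -/
noncomputable def Uc (m : ℕ) : Matrix (Idx m) (Idx m) ℂ := (1 : Matrix (Fin m) (Fin m) ℂ) ⊗ₖ ub

/-- signed doubling -/
def sgnv {m : ℕ} (d : Fin m → ℝ) : Idx m → ℝ := fun p => if p.2 = 0 then d p.1 else - d p.1

theorem sqrt2c : ((Real.sqrt 2 : ℝ) : ℂ)⁻¹ * ((Real.sqrt 2 : ℝ) : ℂ)⁻¹ = 1 / 2 := by
  rw [← mul_inv, ← Complex.ofReal_mul, Real.mul_self_sqrt (by norm_num)]; norm_num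

theorem ub_mul : ub * ubᴴ = 1 := by
  have h := sqrt2c
  rw [ub, Matrix.conjTranspose_smul, Matrix.smul_mul, Matrix.mul_smul, smul_smul]
  simp only [star_inv₀, Complex.star_def, Complex.conj_ofReal]
  rw [h]
  ext i j
  rw [Matrix.smul_apply, Matrix.mul_apply, Fin.sum_univ_two]
  simp only [Matrix.conjTranspose_apply]
  fin_cases i <;> fin_cases j <;> simp <;> norm_num

theorem wb_ub : wb * ub = ub * diagonal ![1, -1] := by
  rw [wb, ub, Matrix.mul_smul, Matrix.smul_mul]
  congr 1
  ext i j
  fin_cases i <;> fin_cases j <;> simp [Matrix.mul_apply, Fin.sum_univ_two]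

theorem wb_mul : wb * wb = 1 := by
  ext i j
  fin_cases i <;> fin_cases j <;> simp [wb, Matrix.mul_apply, Fin.sum_univ_two]

theorem wb_star : wbᴴ = wb := by
  ext i j
  fin_cases i <;> fin_cases j <;> simp [wb, Matrix.conjTranspose_apply]

theorem Wc_mul (m : ℕ) : Wc m * Wc m = 1 := by
  rw [Wc, ← Matrix.mul_kronecker_mul, wb_mul, one_mul, Matrix.one_kronecker_one]

theorem Wc_star (m : ℕ) : (Wc m)ᴴ = Wc m := by
  rw [Wc, Matrix.conjTranspose_kronecker, wb_star, Matrix.conjTranspose_one]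

theorem Uc_mul (m : ℕ) : Uc m * (Uc m)ᴴ = 1 := by
  rw [Uc, Matrix.conjTranspose_kronecker, ← Matrix.mul_kronecker_mul, ub_mul,
    Matrix.conjTranspose_one, one_mul, Matrix.one_kronecker_one]

theorem Uc_mul' (m : ℕ) : (Uc m)ᴴ * Uc m = 1 := mul_eq_one_comm.mp (Uc_mul m)

theorem cplx_pairDiag {m : ℕ} (d : Fin m → ℝ) :
    cplx (pairDiag d) = diagonal (fun i => (d i : ℂ)) ⊗ₖ (1 : Matrix (Fin 2) (Fin 2) ℂ) := by
  rw [← Matrix.diagonal_one, Matrix.diagonal_kronecker_diagonal]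
  ext p q
  simp [cplx, pairDiag, Matrix.diagonal_apply]
  split_ifs <;> simp

theorem diag_sgnv {m : ℕ} (d : Fin m → ℝ) :
    (diagonal (fun p => ((sgnv d p : ℝ) : ℂ)) : Matrix (Idx m) (Idx m) ℂ) =
    diagonal (fun i => (d i : ℂ)) ⊗ₖ diagonal ![1, -1] := by
  rw [Matrix.diagonal_kronecker_diagonal]
  congr 1
  funext p
  obtain ⟨i, j⟩ := p
  fin_cases j <;> simp [sgnv]

theorem pairDiag_Wc {m : ℕ} (d : Fin m → ℝ) :
    cplx (pairDiag d) * Wc m = Uc m * diagonal (fun p => ((sgnv d p : ℝ) : ℂ)) * (Uc m)ᴴ := by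
  have : wb = ub * diagonal ![1, -1] * ubᴴ := by
    rw [← wb_ub, mul_assoc, ub_mul, mul_one]
  rw [cplx_pairDiag, diag_sgnv, Wc, Uc, Matrix.conjTranspose_kronecker, ← Matrix.mul_kronecker_mul,
    ← Matrix.mul_kronecker_mul, ← Matrix.mul_kronecker_mul, ← this]
  simp

theorem pairDiag_comm {m : ℕ} (d : Fin m → ℝ) :
    Wc m * cplx (pairDiag d) = cplx (pairDiag d) * Wc m := by
  rw [cplx_pairDiag, Wc, ← Matrix.mul_kronecker_mul, ← Matrix.mul_kronecker_mul]
  simp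

theorem Wc_eq (m : ℕ) : Wc m = Complex.I • cplx (Omega m) := by
  ext p q
  obtain ⟨i, j⟩ := p
  obtain ⟨k, l⟩ := q
  by_cases h : i = k <;> fin_cases j <;> fin_cases l <;>
    simp [Wc, wb, cplx, Omega, Matrix.one_apply, h]

theorem Omega_mul (m : ℕ) : Omega m * Omega m = -1 := by
  have h := Wc_mul m
  rw [Wc_eq, Matrix.smul_mul, Matrix.mul_smul, smul_smul, Complex.I_mul_I, ← cplx_mul] at h
  ext p q
  have h2 := congrFun (congrFun h p) q
  simp only [cplx, Matrix.smul_apply, Matrix.map_apply] at h2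
  by_cases hpq : p = q
  · subst hpq
    simp at h2
    simp
    have h3 : -(((Omega m * Omega m) p p : ℝ) : ℂ) = ((1:ℝ):ℂ) := by simpa using h2
    have : -((Omega m * Omega m) p p) = 1 := by exact_mod_cast h3
    linarith
  · simp [hpq] at h2
    simp [hpq, h2]

theorem S_inv {m : ℕ} (S : Matrix (Idx m) (Idx m) ℝ) (hS : S * Omega m * Sᵀ = Omega m) :
    S⁻¹ = -(Omega m * Sᵀ * Omega m) := by
  apply Matrix.inv_eq_right_inv
  rw [mul_neg, ← mul_assoc, ← mul_assoc, hS, Omega_mul, neg_neg]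

theorem Omega_transpose (m : ℕ) : (Omega m)ᵀ = -Omega m := by
  ext p q
  obtain ⟨i, j⟩ := p
  obtain ⟨k, l⟩ := q
  by_cases h : i = k
  · subst h
    fin_cases j <;> fin_cases l <;> simp [Omega]
  · have h' : ¬ k = i := fun e => h e.symm
    simp [Omega, h, h']

theorem cplx_neg {n : Type*} (A : Matrix n n ℝ) : cplx (-A) = - cplx A := by
  ext i j; simp [cplx]

theorem cplx_S_inv {m : ℕ} (S : Matrix (Idx m) (Idx m) ℝ) (hS : S * Omega m * Sᵀ = Omega m) :
    cplx S⁻¹ = Wc m * cplx Sᵀ * Wc m := by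
  rw [S_inv S hS, cplx_neg, cplx_mul, cplx_mul, Wc_eq]
  simp [smul_smul]

theorem cplx_S_inv_T {m : ℕ} (S : Matrix (Idx m) (Idx m) ℝ) (hS : S * Omega m * Sᵀ = Omega m) :
    cplx (S⁻¹)ᵀ = Wc m * cplx S * Wc m := by
  rw [S_inv S hS, Matrix.transpose_neg, Matrix.transpose_mul, Matrix.transpose_mul,
    Matrix.transpose_transpose, Omega_transpose, cplx_neg, cplx_mul, cplx_mul, cplx_neg, Wc_eq]
  simp [smul_smul, mul_assoc]

theorem norm_le_one_of {n : Type*} [Fintype n] [DecidableEq n] (A : Matrix n n ℂ)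
    (h : Aᴴ * A = 1) : ‖A‖ ≤ 1 := by
  have h1 := Matrix.l2_opNorm_conjTranspose_mul_self A
  rw [h, ← Matrix.diagonal_one, Matrix.l2_opNorm_diagonal] at h1
  have h2 : ‖(fun _ : n => (1:ℂ))‖ ≤ 1 := by
    rw [pi_norm_le_iff_of_nonneg zero_le_one]; simp
  nlinarith [norm_nonneg A]

theorem norm_mul3 {n : Type*} [Fintype n] [DecidableEq n] (A B C : Matrix n n ℂ) (a b c : ℝ)
    (ha : ‖A‖ ≤ a) (hb : ‖B‖ ≤ b) (hc : ‖C‖ ≤ c) : ‖A * B * C‖ ≤ a * b * c := by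
  have := (norm_nonneg A).trans ha
  have := (norm_nonneg B).trans hb
  refine (norm_mul_le _ _).trans ?_
  gcongr
  exact (norm_mul_le _ _).trans (by gcongr)

theorem sgnv_ne {m : ℕ} {d : Fin m → ℝ} (hd : ∀ i, 0 < d i) (p : Idx m) : sgnv d p ≠ 0 := by
  have := hd p.1
  unfold sgnv; split_ifs <;> linarith [this]

theorem coth_id (x : ℝ) (hx : x ≠ 0) : rcoth x = 1 + 2 * (Real.exp (2 * x) - 1)⁻¹ := by
  have h1 : Real.exp (2*x) - 1 ≠ 0 := fun h => by
    have : Real.exp (2 * x) = 1 := by linarith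
    rw [Real.exp_eq_one_iff] at this
    exact hx (by linarith)
  have h2 : Real.sinh x ≠ 0 := by simpa using hx
  have e : Real.exp (2*x) = Real.exp x * Real.exp x := by rw [← Real.exp_add]; ring_nf
  have e2 : Real.exp x * Real.exp (-x) = 1 := by rw [← Real.exp_add]; simp
  rw [rcoth, div_eq_iff h2, Real.cosh_eq, Real.sinh_eq]
  rw [e] at h1 ⊢
  have hk := inv_mul_cancel₀ h1
  linear_combination (-Real.exp (-x)) * hk + (Real.exp x * Real.exp x - 1)⁻¹ * Real.exp x * e2

theorem rcoth_neg (x : ℝ) : rcoth (-x) = - rcoth x := by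
  simp [rcoth, div_neg]

/-- simultaneous structure of `H` and `V`. -/
theorem structure_lemma {m : ℕ} (S : Matrix (Idx m) (Idx m) ℝ) (hS : S * Omega m * Sᵀ = Omega m)
    (d : Fin m → ℝ) (hd : ∀ i, 0 < d i) :
    ∃ R R' : Matrix (Idx m) (Idx m) ℂ, R * R' = 1 ∧ R' * R = 1 ∧ ‖R‖ ≤ spNorm S ∧ ‖R'‖ ≤ spNorm S ∧
      (2:ℂ) • (cplx ((S⁻¹)ᵀ * pairDiag d * S⁻¹) * Wc m) =
        R * diagonal (fun p => ((2 * sgnv d p : ℝ) : ℂ)) * R' ∧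
      Wc m * cplx (S * pairDiag (fun i => rcoth (d i)) * Sᵀ) =
        1 + (2:ℂ) • (R * diagonal (gv (sgnv d)) * R') := by
  have hW := Wc_mul m
  have nW : ‖Wc m‖ ≤ 1 := norm_le_one_of _ (by rw [Wc_star, hW])
  have nU : ‖Uc m‖ ≤ 1 := norm_le_one_of _ (Uc_mul' m)
  have nU' : ‖(Uc m)ᴴ‖ ≤ 1 := by rw [Matrix.l2_opNorm_conjTranspose]; exact nU
  have nS := cplx_norm_le S
  have nST : ‖cplx Sᵀ‖ ≤ spNorm S := by rw [cplx_transpose_norm]; exact nS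
  have hs : cplx S * Wc m * cplx Sᵀ = Wc m := by
    rw [Wc_eq, Matrix.mul_smul, Matrix.smul_mul, ← cplx_mul, ← cplx_mul, hS]
  have hR1 : (cplx S * Wc m) * (cplx Sᵀ * Wc m) = 1 := by
    rw [← mul_assoc, hs, hW]
  have hR2 : (cplx Sᵀ * Wc m) * (cplx S * Wc m) = 1 := mul_eq_one_comm.mp hR1
  have hRR : (Wc m * cplx S * Wc m * Uc m) * ((Uc m)ᴴ * cplx Sᵀ) = 1 := by
    calc _ = Wc m * cplx S * Wc m * (Uc m * (Uc m)ᴴ) * cplx Sᵀ := by simp only [mul_assoc]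
      _ = Wc m * (cplx S * Wc m * cplx Sᵀ) := by rw [Uc_mul, mul_one]; simp only [mul_assoc]
      _ = 1 := by rw [hs, hW]
  refine ⟨Wc m * cplx S * Wc m * Uc m, (Uc m)ᴴ * cplx Sᵀ, hRR, mul_eq_one_comm.mp hRR,
    ?_, ?_, ?_, ?_⟩
  · have h1 := norm_mul3 _ _ _ _ _ _ nW nS nW
    refine (norm_mul_le _ _).trans ?_
    have := norm_nonneg (Wc m * cplx S * Wc m)
    nlinarith [norm_nonneg (Uc m)]
  · refine (norm_mul_le _ _).trans ?_
    nlinarith [norm_nonneg (cplx Sᵀ), norm_nonneg (Uc m)ᴴ]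
  · have e : (diagonal (fun p => ((2 * sgnv d p : ℝ) : ℂ)) : Matrix (Idx m) (Idx m) ℂ) =
        (2:ℂ) • diagonal (fun p => ((sgnv d p : ℝ) : ℂ)) := by
      rw [← Matrix.diagonal_smul]; congr 1; funext p; simp
    rw [e, Matrix.mul_smul, Matrix.smul_mul, cplx_mul, cplx_mul, cplx_S_inv S hS, cplx_S_inv_T S hS]
    refine congrArg (fun Y => (2:ℂ) • Y) ?_
    calc _ = Wc m * cplx S * Wc m * (cplx (pairDiag d) * Wc m) * cplx Sᵀ * (Wc m * Wc m) := by
          simp only [mul_assoc]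
      _ = _ := by rw [pairDiag_Wc, hW, mul_one]; simp only [mul_assoc]
  · have e : (diagonal (fun p => ((sgnv (fun i => rcoth (d i)) p : ℝ) : ℂ)) :
        Matrix (Idx m) (Idx m) ℂ) = 1 + (2:ℂ) • diagonal (gv (sgnv d)) := by
      rw [← Matrix.diagonal_one, ← Matrix.diagonal_smul, Matrix.diagonal_add]
      congr 1; funext p
      have : sgnv (fun i => rcoth (d i)) p = rcoth (sgnv d p) := by
        unfold sgnv; split_ifs
        · rfl
        · rw [rcoth_neg]
      rw [this, coth_id _ (sgnv_ne hd p)]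
      simp [gv]
    rw [cplx_mul, cplx_mul]
    calc _ = Wc m * cplx S * (Wc m * Wc m) * cplx (pairDiag fun i => rcoth (d i)) * cplx Sᵀ := by
          rw [hW, mul_one]; simp only [mul_assoc]
      _ = Wc m * cplx S * Wc m * (Wc m * cplx (pairDiag fun i => rcoth (d i))) * cplx Sᵀ := by
          simp only [mul_assoc]
      _ = (Wc m * cplx S * Wc m * Uc m) * (1 + (2:ℂ) • diagonal (gv (sgnv d))) * ((Uc m)ᴴ * cplx Sᵀ) := by
          rw [pairDiag_comm, pairDiag_Wc, e]; simp only [mul_assoc]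
      _ = _ := by
          rw [mul_add, add_mul, mul_one, hRR, Matrix.mul_smul, Matrix.smul_mul]

theorem one_le_spNorm {m : ℕ} (hm : 0 < m) (S : Matrix (Idx m) (Idx m) ℝ)
    (hS : S * Omega m * Sᵀ = Omega m) : 1 ≤ spNorm S := by
  obtain ⟨R, R', h1, -, n1, n2, -⟩ := structure_lemma S hS (fun _ => 1) (fun _ => one_pos)
  have : ‖(1 : Matrix (Idx m) (Idx m) ℂ)‖ = 1 := by
    haveI : Nonempty (Idx m) := ⟨(⟨0, hm⟩, 0)⟩
    rw [← Matrix.diagonal_one, Matrix.l2_opNorm_diagonal]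
    exact (pi_norm_const (1:ℂ)).trans (by simp)
  have h2 := norm_mul_le R R'
  rw [h1, this] at h2
  have h0 : 0 ≤ spNorm S := norm_nonneg _
  have : ‖R‖ * ‖R'‖ ≤ spNorm S * spNorm S := by gcongr
  nlinarith

theorem gv_norm {m : ℕ} (d : Fin m → ℝ) (hd : ∀ i, 0 < d i) (dmin : ℝ) (h0 : 0 < dmin)
    (hmin : ∀ i, dmin ≤ d i) :
    ‖(diagonal (gv (sgnv d)) : Matrix (Idx m) (Idx m) ℂ)‖ ≤ 1 / (1 - Real.exp (-2 * dmin)) := by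
  have hc : 0 < 1 - Real.exp (-2 * dmin) := by
    have : Real.exp (-2 * dmin) < 1 := by rw [Real.exp_lt_one_iff]; linarith
    linarith
  rw [Matrix.l2_opNorm_diagonal, pi_norm_le_iff_of_nonneg (by positivity)]
  intro p
  rw [gv, Complex.norm_real, Real.norm_eq_abs, abs_inv, ← one_div]
  apply one_div_le_one_div_of_le hc
  have hp := hmin p.1
  have a1 : Real.exp (-2 * d p.1) ≤ Real.exp (-2 * dmin) := Real.exp_le_exp.mpr (by linarith)
  unfold sgnv
  split_ifs
  · have a2 : Real.exp (2 * d p.1) * Real.exp (-2 * d p.1) = 1 := by rw [← Real.exp_add]; simp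
    have a3 : 1 ≤ Real.exp (2 * d p.1) := Real.one_le_exp (by linarith)
    refine le_trans ?_ (le_abs_self _)
    nlinarith [Real.exp_pos (-2 * d p.1)]
  · have : 2 * -d p.1 = -2 * d p.1 := by ring
    rw [this]
    refine le_trans ?_ (neg_le_abs _)
    linarith

theorem main_aux {m : ℕ} (hm : 0 < m)
    (S₁ S₂ : Matrix (Idx m) (Idx m) ℝ)
    (hS₁ : S₁ * Omega m * S₁ᵀ = Omega m) (hS₂ : S₂ * Omega m * S₂ᵀ = Omega m)
    (d₁ d₂ : Fin m → ℝ) (hd₁ : ∀ i, 0 < d₁ i) (hd₂ : ∀ i, 0 < d₂ i)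
    (H₁ H₂ : Matrix (Idx m) (Idx m) ℝ)
    (hH₁ : H₁ = (S₁⁻¹)ᵀ * pairDiag d₁ * S₁⁻¹) (hH₂ : H₂ = (S₂⁻¹)ᵀ * pairDiag d₂ * S₂⁻¹)
    (V₁ V₂ : Matrix (Idx m) (Idx m) ℝ)
    (hV₁ : cplx (S₁ * pairDiag (fun i => rcoth (d₁ i)) * S₁ᵀ) = (2:ℂ) • cplx V₁)
    (hV₂ : cplx (S₂ * pairDiag (fun i => rcoth (d₂ i)) * S₂ᵀ) = (2:ℂ) • cplx V₂)
    (dmin dmax : ℝ) (hdmin0 : 0 < dmin)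
    (hdmin_le : ∀ i, dmin ≤ d₁ i)
    (hdmax_le : ∀ i, d₁ i ≤ dmax) 
    (hHH : spNorm (H₁ - H₂) ≤
      (1 / (4 * spNorm S₁ ^ 6)) * Real.exp (-2 * dmax - 1) * (1 - Real.exp (-2 * dmin))) :
    spNorm (V₁ - V₂) ≤
      4 * spNorm S₁ ^ 8 * Real.exp (2 * dmax + 1) * spNorm (H₁ - H₂) /
        (1 - Real.exp (-2 * dmin)) ^ 2 := by
  have hs1 := one_le_spNorm hm S₁ hS₁
  obtain ⟨R, R', r1, r2, n1, n2, eH1, eV1⟩ := structure_lemma S₁ hS₁ d₁ hd₁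
  obtain ⟨T, T', t1, t2, -, -, eH2, eV2⟩ := structure_lemma S₂ hS₂ d₂ hd₂
  rw [← hH₁] at eH1
  rw [← hH₂] at eH2
  rw [hV₁] at eV1
  rw [hV₂] at eV2
  have hg := gv_norm d₁ hd₁ dmin hdmin0 hdmin_le
  have hW := Wc_mul m
  have nW : ‖Wc m‖ ≤ 1 := norm_le_one_of _ (by rw [Wc_star, hW])
  set s := spNorm S₁
  set h := spNorm (H₁ - H₂)
  have h0 : 0 ≤ h := norm_nonneg _
  have hc : 0 < 1 - Real.exp (-2 * dmin) := by
    have : Real.exp (-2 * dmin) < 1 := by rw [Real.exp_lt_one_iff]; linarith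
    linarith
  have hc1 : 1 - Real.exp (-2 * dmin) ≤ 1 := by linarith [Real.exp_pos (-2 * dmin)]
  set c := 1 - Real.exp (-2 * dmin)
  have hdmax0 : 0 < dmax := (hd₁ ⟨0, hm⟩).trans_le (hdmax_le _)
  have hee : Real.exp (-2 * dmax - 1) * Real.exp (2 * dmax + 1) = 1 := by
    rw [← Real.exp_add]; ring_nf; simp
  have he1 : 1 ≤ Real.exp (2 * dmax + 1) := Real.one_le_exp (by linarith)
  have he0 := Real.exp_pos (-2 * dmax - 1)
  set X := Real.exp (2 * dmax + 1)
  have hsm : 2 * s ^ 2 * h * X ≤ c / 2 := by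
    have k1 : h * X ≤ 1 / (4 * s ^ 6) * c := by
      calc h * X ≤ ((1 / (4 * s ^ 6)) * Real.exp (-2 * dmax - 1) * c) * X := by gcongr
        _ = 1 / (4 * s ^ 6) * c * (Real.exp (-2 * dmax - 1) * X) := by ring
        _ = _ := by rw [hee, mul_one]
    have k2 : 1 / (4 * s ^ 6) ≤ 1 / (4 * s ^ 2) := by
      apply one_div_le_one_div_of_le (by positivity)
      have := pow_le_pow_right₀ hs1 (show 2 ≤ 6 by norm_num)
      linarith
    calc 2 * s ^ 2 * h * X = 2 * s ^ 2 * (h * X) := by ring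
      _ ≤ 2 * s ^ 2 * (1 / (4 * s ^ 2) * c) :=
        mul_le_mul_of_nonneg_left (k1.trans (mul_le_mul_of_nonneg_right k2 hc.le)) (by positivity)
      _ = c / 2 := by field_simp; norm_num
  have hε1 : 2 * s ^ 2 * h ≤ 1 := by
    have : 2 * s ^ 2 * h * 1 ≤ 2 * s ^ 2 * h * X := by gcongr
    linarith
  have conj1 : diagonal (fun p => ((2 * sgnv d₁ p : ℝ) : ℂ)) = R' * ((2:ℂ) • (cplx H₁ * Wc m)) * R := by
    rw [eH1]
    calc _ = (R' * R) * diagonal (fun p => ((2 * sgnv d₁ p : ℝ) : ℂ)) * (R' * R) := by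
          rw [r2, one_mul, mul_one]
      _ = _ := by simp only [mul_assoc]
  have conj2 : (R' * T) * diagonal (fun p => ((2 * sgnv d₂ p : ℝ) : ℂ)) * (T' * R) =
      R' * ((2:ℂ) • (cplx H₂ * Wc m)) * R := by
    rw [eH2]; simp only [mul_assoc]
  have q1 : (R' * T) * (T' * R) = 1 := by
    calc _ = R' * (T * T') * R := by simp only [mul_assoc]
      _ = 1 := by rw [t1, mul_one, r2]
  have nH : ‖cplx (H₁ - H₂)‖ ≤ h := cplx_norm_le _
  have key := aux_core (R' * T) (T' * R) (sgnv d₁) (sgnv d₂) (sgnv_ne hd₁) (sgnv_ne hd₂)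
    q1 (mul_eq_one_comm.mp q1) c (2 * dmax) (2 * s ^ 2 * h) hc hε1
    (by
      intro p
      have a1 := hd₁ p.1
      have a2 := hdmax_le p.1
      rw [abs_le]
      unfold sgnv; split_ifs <;> constructor <;> linarith)
    (by linarith) hg
    (by
      rw [conj1, conj2]
      have : R' * ((2:ℂ) • (cplx H₁ * Wc m)) * R - R' * ((2:ℂ) • (cplx H₂ * Wc m)) * R =
          (2:ℂ) • (R' * (cplx (H₁ - H₂) * Wc m) * R) := by
        rw [cplx_sub, sub_mul, mul_sub, sub_mul, smul_sub]
        simp only [Matrix.mul_smul, Matrix.smul_mul]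
      rw [this, norm_smul]
      have b1 : ‖cplx (H₁ - H₂) * Wc m‖ ≤ h := by
        refine (norm_mul_le _ _).trans ?_
        calc _ ≤ h * 1 := by gcongr
          _ = h := mul_one h
      have b2 := norm_mul3 _ _ _ _ _ _ n2 b1 n1
      have : ‖(2:ℂ)‖ = 2 := by simp
      rw [this]
      calc _ ≤ 2 * (s * h * s) := by gcongr
        _ = _ := by ring)
    hsm
  have eV : cplx (V₁ - V₂) =
      (Wc m * R) * (diagonal (gv (sgnv d₁)) - (R' * T) * diagonal (gv (sgnv d₂)) * (T' * R)) * R' := by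
    have z1 : (2:ℂ) • (Wc m * cplx V₁ - Wc m * cplx V₂) =
        (2:ℂ) • (R * diagonal (gv (sgnv d₁)) * R' - T * diagonal (gv (sgnv d₂)) * T') := by
      rw [smul_sub, smul_sub, ← Matrix.mul_smul, ← Matrix.mul_smul, eV1, eV2]
      abel
    have z2 := smul_right_injective _ (two_ne_zero (α := ℂ)) z1
    have z3 : T * diagonal (gv (sgnv d₂)) * T' =
        R * ((R' * T) * diagonal (gv (sgnv d₂)) * (T' * R)) * R' := by
      calc _ = (R * R') * (T * diagonal (gv (sgnv d₂)) * T') * (R * R') := by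
            rw [r1, one_mul, mul_one]
        _ = _ := by simp only [mul_assoc]
    calc cplx (V₁ - V₂) = (Wc m * Wc m) * (cplx V₁ - cplx V₂) := by rw [hW, one_mul, cplx_sub]
      _ = Wc m * (Wc m * cplx V₁ - Wc m * cplx V₂) := by rw [mul_assoc, mul_sub]
      _ = Wc m * (R * diagonal (gv (sgnv d₁)) * R' -
          R * ((R' * T) * diagonal (gv (sgnv d₂)) * (T' * R)) * R') := by rw [← z3]; exact congrArg _ z2
      _ = _ := by rw [← sub_mul, ← mul_sub]; simp only [mul_assoc]
  have nWR : ‖Wc m * R‖ ≤ s := by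
    refine (norm_mul_le _ _).trans ?_
    calc _ ≤ 1 * s := by gcongr
      _ = s := one_mul s
  have fin := norm_mul3 _ _ _ _ _ _ nWR key n2
  rw [← eV] at fin
  refine (le_cplx_norm _).trans (fin.trans ?_)
  have hp := pow_le_pow_right₀ hs1 (show 4 ≤ 8 by norm_num)
  calc s * (2 / c ^ 2 * (2 * s ^ 2 * h * X)) * s = 4 * s ^ 4 * X * h / c ^ 2 := by ring
    _ ≤ _ := by gcongr

end mainproof
/-- Continuity of the covariance matrix in the Hamiltonian: if
`‖H₁ - H₂‖∞ ≤ (1/(4‖S‖∞⁶))·e^{-2 d_max - 1}·(1 - e^{-2 d_min})` then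
`‖V₁ - V₂‖∞ ≤ 4·‖S‖∞⁸·e^{2 d_max + 1}·‖H₁ - H₂‖∞/(1 - e^{-2 d_min})²`. -/
theorem statement8 {m : ℕ} (hm : 0 < m)
    (S₁ S₂ : Matrix (Idx m) (Idx m) ℝ)
    (hS₁ : S₁ * Omega m * S₁ᵀ = Omega m) (hS₂ : S₂ * Omega m * S₂ᵀ = Omega m)
    (d₁ d₂ : Fin m → ℝ) (hd₁ : ∀ i, 0 < d₁ i) (hd₂ : ∀ i, 0 < d₂ i)
    (H₁ H₂ : Matrix (Idx m) (Idx m) ℝ)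
    (hH₁ : H₁ = (S₁⁻¹)ᵀ * pairDiag d₁ * S₁⁻¹) (hH₂ : H₂ = (S₂⁻¹)ᵀ * pairDiag d₂ * S₂⁻¹)
    (V₁ V₂ : Matrix (Idx m) (Idx m) ℝ)
    (hV₁ : V₁ = (1/2 : ℝ) • (S₁ * pairDiag (fun i => rcoth (d₁ i)) * S₁ᵀ))
    (hV₂ : V₂ = (1/2 : ℝ) • (S₂ * pairDiag (fun i => rcoth (d₂ i)) * S₂ᵀ))
    (dmin dmax : ℝ)
    (hdmin_le : ∀ i, dmin ≤ d₁ i) (hdmin_mem : ∃ i, d₁ i = dmin)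
    (hdmax_le : ∀ i, d₁ i ≤ dmax) (hdmax_mem : ∃ i, d₁ i = dmax)
    (hHH : spNorm (H₁ - H₂) ≤
      (1 / (4 * spNorm S₁ ^ 6)) * Real.exp (-2 * dmax - 1) * (1 - Real.exp (-2 * dmin))) :
    spNorm (V₁ - V₂) ≤
      4 * spNorm S₁ ^ 8 * Real.exp (2 * dmax + 1) * spNorm (H₁ - H₂) /
        (1 - Real.exp (-2 * dmin)) ^ 2 := by
  have hc : ∀ A : Matrix (Idx m) (Idx m) ℝ, cplx A = (2:ℂ) • cplx ((1/2 : ℝ) • A) := by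
    intro A; ext i j; simp [cplx]
  have hmin0 : 0 < dmin := by
    obtain ⟨i, hi⟩ := hdmin_mem
    rw [← hi]; exact hd₁ i
  exact main_aux hm S₁ S₂ hS₁ hS₂ d₁ d₂ hd₁ hd₂ H₁ H₂ hH₁ hH₂ V₁ V₂
    (by rw [hV₁]; exact hc _) (by rw [hV₂]; exact hc _) dmin dmax hmin0 hdmin_le hdmax_le hHH
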